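/- Let Γ be a nontrivial finite cyclic group and let G be a group whose abelianization has rank 0 (i.e., G^{ab} is torsion). Then Γ × ℤ cannot be expressed as a quotient of the free product G * ℤ^{*k} (the free product of G with k copies of ℤ) by the normal closure of k−1 elements r_1, …, r_{k−1}. -/

import Mathlib

/-- Affine group `V ⋊ ℂˣ`. -/
@[ext] structure AffG (V : Type*) where
  u : ℂˣ
  v : V

instance affGroup {V : Type*} [AddCommGroup V] [Module ℂ V] : Group (AffG V) :=
  letI : Mul (AffG V) := ⟨fun a b => ⟨a.u * b.u, a.v + (a.u : ℂ) • b.v⟩⟩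
  letI : One (AffG V) := ⟨⟨1, 0⟩⟩
  letI : Inv (AffG V) := ⟨fun a => ⟨a.u⁻¹, -(((a.u⁻¹ : ℂˣ) : ℂ) • a.v)⟩⟩
  Group.ofLeftAxioms
    (fun a b c => by
      refine AffG.ext (mul_assoc _ _ _) ?_
      change (a.v + (a.u : ℂ) • b.v) + ((a.u * b.u : ℂˣ) : ℂ) • c.v
        = a.v + (a.u : ℂ) • (b.v + (b.u : ℂ) • c.v)
      rw [smul_add, smul_smul, Units.val_mul, add_assoc])
    (fun a => by
      refine AffG.ext (one_mul _) ?_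
      change (0 : V) + ((1 : ℂˣ) : ℂ) • a.v = a.v
      simp)
    (fun a => by
      refine AffG.ext (inv_mul_cancel _) ?_
      change -(((a.u⁻¹ : ℂˣ) : ℂ) • a.v) + ((a.u⁻¹ : ℂˣ) : ℂ) • a.v = 0
      simp)

theorem affG_mul_u {V : Type*} [AddCommGroup V] [Module ℂ V] (a b : AffG V) :
    (a * b).u = a.u * b.u := rfl

theorem affG_mul_v {V : Type*} [AddCommGroup V] [Module ℂ V] (a b : AffG V) :
    (a * b).v = a.v + (a.u : ℂ) • b.v := rfl

/-- Heisenberg group over a ring. -/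
@[ext] structure HeisG (R : Type*) where
  a : R
  b : R
  c : R

instance heisGroup {R : Type*} [CommRing R] : Group (HeisG R) :=
  letI : Mul (HeisG R) := ⟨fun x y => ⟨x.a + y.a, x.b + y.b, x.c + y.c + x.a * y.b⟩⟩
  letI : One (HeisG R) := ⟨⟨0, 0, 0⟩⟩
  letI : Inv (HeisG R) := ⟨fun x => ⟨-x.a, -x.b, -x.c + x.a * x.b⟩⟩
  Group.ofLeftAxioms
    (fun x y z => by
      refine HeisG.ext (add_assoc _ _ _) (add_assoc _ _ _) ?_
      change (x.c + y.c + x.a * y.b) + z.c + (x.a + y.a) * z.b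
        = x.c + (y.c + z.c + y.a * z.b) + x.a * (y.b + z.b)
      ring)
    (fun x => by
      refine HeisG.ext (zero_add _) (zero_add _) ?_
      change 0 + x.c + 0 * x.b = x.c
      ring)
    (fun x => by
      refine HeisG.ext (neg_add_cancel _) (neg_add_cancel _) ?_
      change (-x.c + x.a * x.b) + x.c + (-x.a) * x.b = 0
      ring)

theorem heisG_mul_a {R : Type*} [CommRing R] (x y : HeisG R) : (x * y).a = x.a + y.a := rfl
theorem heisG_mul_b {R : Type*} [CommRing R] (x y : HeisG R) : (x * y).b = x.b + y.b := rfl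
theorem heisG_mul_c {R : Type*} [CommRing R] (x y : HeisG R) :
    (x * y).c = x.c + y.c + x.a * y.b := rfl

open Monoid in
theorem exists_fox {G : Type*} [Group G] {k : ℕ} (χ : Coprod G (FreeGroup (Fin k)) →* ℂˣ) :
    ∃ D : Coprod G (FreeGroup (Fin k)) → (Fin k → ℂ),
      (∀ x y, D (x * y) = D x + (χ x : ℂ) • D y) ∧ (∀ g, D (Coprod.inl g) = 0) ∧
      ∀ i, D (Coprod.inr (FreeGroup.of i)) = Pi.single i 1 := by
  let iG : G →* AffG (Fin k → ℂ) := MonoidHom.mk' (fun g => ⟨χ (Coprod.inl g), 0⟩) (by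
    intro a b
    refine AffG.ext ?_ ?_
    · simp [affG_mul_u]
    · simp [affG_mul_v])
  let Φ : Coprod G (FreeGroup (Fin k)) →* AffG (Fin k → ℂ) :=
    Coprod.lift iG (FreeGroup.lift fun i => ⟨χ (Coprod.inr (FreeGroup.of i)), Pi.single i 1⟩)
  let pr : AffG (Fin k → ℂ) →* ℂˣ := MonoidHom.mk' (fun x => x.u) (fun _ _ => rfl)
  have hΦ : pr.comp Φ = χ := by
    apply Coprod.hom_ext
    · ext g
      simp [Φ, iG, pr]
    · ext i
      simp [Φ, pr]
  have hu : ∀ x, (Φ x).u = χ x := fun x => DFunLike.congr_fun hΦ x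
  refine ⟨fun x => (Φ x).v, ?_, ?_, ?_⟩
  · intro x y
    simp only [map_mul, affG_mul_v, hu]
  · intro g
    simp [Φ, iG]
  · intro i
    simp [Φ]

/-- A derivation killing relators kills the normal closure. -/
theorem fox_kill {P : Type*} [Group P] (χ : P →* ℂˣ) (d : P → ℂ)
    (hd : ∀ x y, d (x * y) = d x + (χ x : ℂ) * d y) (s : Set P)
    (h1 : ∀ x ∈ s, χ x = 1) (h2 : ∀ x ∈ s, d x = 0) :
    ∀ x ∈ Subgroup.normalClosure s, d x = 0 := by
  let Φ : P →* AffG ℂ := MonoidHom.mk' (fun x => ⟨χ x, d x⟩) (by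
    intro a b
    refine AffG.ext ?_ ?_
    · simp [affG_mul_u]
    · simp [affG_mul_v, hd])
  have : Subgroup.normalClosure s ≤ Φ.ker := by
    apply Subgroup.normalClosure_le_normal
    intro x hx
    exact AffG.ext (h1 x hx) (h2 x hx)
  intro x hx
  have := this hx
  exact congrArg AffG.v (MonoidHom.mem_ker.1 this)

open Monoid in
theorem case_one {G : Type*} [Group G] {A : Type*} [CommGroup A] {m : ℕ}
    (r : Fin m → Coprod G (FreeGroup (Fin (m + 1))))
    (q : Coprod G (FreeGroup (Fin (m + 1))) →* A)
    (hq : q.ker = Subgroup.normalClosure (Set.range r)) (χ : A →* ℂˣ) (g : G)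
    (hg : χ (q (Coprod.inl g)) ≠ 1) : False := by
  obtain ⟨D, hD, hDG, hDi⟩ := exists_fox (χ.comp q)
  have hlt : Submodule.span ℂ (Set.range fun i => D (r i)) < ⊤ := by
    rw [lt_top_iff_ne_top]
    intro h
    have h1 := finrank_range_le_card (R := ℂ) (fun i => D (r i))
    rw [Set.finrank, h] at h1
    simp at h1
  obtain ⟨f, hf0, hf⟩ := Submodule.exists_le_ker_of_lt_top _ hlt
  have hr : ∀ i, q (r i) = 1 := fun i => by
    rw [← MonoidHom.mem_ker, hq]
    exact Subgroup.subset_normalClosure ⟨i, rfl⟩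
  have hd : ∀ x y, f (D (x * y)) = f (D x) + ((χ.comp q) x : ℂ) * f (D y) := by
    intro x y
    rw [hD, map_add, map_smul, smul_eq_mul]
  have hk := fox_kill (χ.comp q) (fun x => f (D x)) hd (Set.range r)
    (by rintro _ ⟨i, rfl⟩; simp [hr])
    (by
      rintro _ ⟨i, rfl⟩
      exact hf (Submodule.subset_span ⟨i, rfl⟩))
  rw [← hq] at hk
  apply hf0
  have key : ∀ x, f (D x) = 0 := by
    intro x
    have h1 : x * Coprod.inl g = (x * Coprod.inl g * x⁻¹ * (Coprod.inl g)⁻¹) * (Coprod.inl g * x) := by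
      group
    have hc : q (x * Coprod.inl g * x⁻¹ * (Coprod.inl g)⁻¹) = 1 := by
      simp [mul_comm]
    have h2 := hd (x * Coprod.inl g * x⁻¹ * (Coprod.inl g)⁻¹) (Coprod.inl g * x)
    rw [← h1, hk _ (MonoidHom.mem_ker.2 hc), MonoidHom.comp_apply, hc, hd, hd, hDG] at h2
    simp only [map_zero, mul_zero, add_zero, map_one, Units.val_one, one_mul, zero_add,
      MonoidHom.comp_apply] at h2
    by_contra h0
    apply hg
    ext
    have h3 : (1 - (χ (q (Coprod.inl g)) : ℂ)) * f (D x) = 0 := by linear_combination h2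
    rcases mul_eq_zero.1 h3 with h | h
    · simp only [Units.val_one]
      linear_combination -h
    · exact absurd h h0
  refine LinearMap.pi_ext' fun i => ?_
  ext
  simpa [hDi] using key (Coprod.inr (FreeGroup.of i))

open Monoid in
theorem case_two {G : Type*} [Group G] {n m : ℕ} [NeZero n] (hn : n ≠ 1)
    (r : Fin m → Coprod G (FreeGroup (Fin (m + 1))))
    (q : Coprod G (FreeGroup (Fin (m + 1))) →* Multiplicative (ZMod n) × Multiplicative ℤ)
    (hs : Function.Surjective q)
    (hq : q.ker = Subgroup.normalClosure (Set.range r))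
    (hg : ∀ g, q (Coprod.inl g) = 1) : False := by
  obtain ⟨D, hD, hDG, hDi⟩ := exists_fox
    (1 : Coprod G (FreeGroup (Fin (m + 1))) →* ℂˣ)
  have hD : ∀ x y, D (x * y) = D x + D y := by
    intro x y; simpa using hD x y
  have hr : ∀ i, q (r i) = 1 := fun i => by
    rw [← MonoidHom.mem_ker, hq]
    exact Subgroup.subset_normalClosure ⟨i, rfl⟩
  obtain ⟨a, ha⟩ := hs (Multiplicative.ofAdd 1, 1)
  obtain ⟨t, ht⟩ := hs (1, Multiplicative.ofAdd 1)
  -- independence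
  let w : Option (Fin m) → (Fin (m + 1) → ℂ) := fun o => o.elim (D t) (fun i => D (r i))
  have hli : LinearIndependent ℂ w := by
    apply linearIndependent_of_top_le_span_of_card_eq_finrank
    swap
    · simp
    by_contra hlt
    obtain ⟨f, hf0, hf⟩ := Submodule.exists_le_ker_of_lt_top _
      (lt_top_iff_ne_top.2 fun h => hlt h.ge)
    have hd : ∀ x y, f (D (x * y)) = f (D x) + f (D y) := by
      intro x y
      rw [hD, map_add]
    let d : Coprod G (FreeGroup (Fin (m + 1))) →* Multiplicative ℂ :=
      MonoidHom.mk' (fun x => Multiplicative.ofAdd (f (D x))) (fun x y => by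
        rw [hd, ofAdd_add])
    have hk : q.ker ≤ d.ker := by
      rw [hq]
      apply Subgroup.normalClosure_le_normal
      rintro _ ⟨i, rfl⟩
      exact hf (Submodule.subset_span ⟨some i, rfl⟩)
    have hdt : d t = 1 := hf (Submodule.subset_span ⟨none, rfl⟩)
    have key : ∀ x, d x = 1 := by
      intro x
      have h1 : x ^ n * (t ^ (n * Multiplicative.toAdd (q x).2))⁻¹ ∈ q.ker := by
        rw [MonoidHom.mem_ker, map_mul, map_inv, map_pow, map_zpow, ht]
        apply Prod.ext
        · apply Multiplicative.toAdd.injective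
          simp
        · apply Multiplicative.toAdd.injective
          simp
      have h2 := hk h1
      rw [MonoidHom.mem_ker, map_mul, map_inv, map_pow, map_zpow, hdt] at h2
      simp only [one_zpow, inv_one, mul_one] at h2
      have h3 : n • Multiplicative.toAdd (d x) = 0 := congrArg Multiplicative.toAdd h2
      apply Multiplicative.toAdd.injective
      simpa [NeZero.ne n] using h3
    apply hf0
    refine LinearMap.pi_ext' fun i => ?_
    ext
    have := congrArg Multiplicative.toAdd (key (Coprod.inr (FreeGroup.of i)))
    simpa [hDi, d] using this
  have hli2 : LinearIndependent ℂ (fun i => D (r i)) :=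
    hli.comp some (Option.some_injective _)
  -- the Heisenberg lift
  let φ : Coprod G (FreeGroup (Fin (m + 1))) →* HeisG (ZMod n) :=
    Coprod.lift 1 (FreeGroup.lift fun i =>
      ⟨Multiplicative.toAdd (q (Coprod.inr (FreeGroup.of i))).1,
        ((Multiplicative.toAdd (q (Coprod.inr (FreeGroup.of i))).2 : ℤ) : ZMod n), 0⟩)
  let p1 : HeisG (ZMod n) →* Multiplicative (ZMod n) :=
    MonoidHom.mk' (fun x => Multiplicative.ofAdd x.a) (fun _ _ => rfl)
  let p2 : HeisG (ZMod n) →* Multiplicative (ZMod n) :=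
    MonoidHom.mk' (fun x => Multiplicative.ofAdd x.b) (fun _ _ => rfl)
  have e1 : p1.comp φ = (MonoidHom.fst _ _).comp q := by
    apply Coprod.hom_ext
    · ext g
      simp [φ, hg]
    · ext i
      simp [φ, p1]
  have e2 : p2.comp φ =
      (AddMonoidHom.toMultiplicative (Int.castAddHom (ZMod n))).comp
        ((MonoidHom.snd _ _).comp q) := by
    apply Coprod.hom_ext
    · ext g
      simp [φ, hg]
    · ext i
      simp [φ, p2]
  have f1 : ∀ x, (φ x).a = Multiplicative.toAdd (q x).1 := fun x =>
    congrArg Multiplicative.toAdd (DFunLike.congr_fun e1 x)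
  have f2 : ∀ x, (φ x).b = ((Multiplicative.toAdd (q x).2 : ℤ) : ZMod n) := fun x =>
    congrArg Multiplicative.toAdd (DFunLike.congr_fun e2 x)
  have g1 : ∀ x, q x = 1 → (φ x).a = 0 := fun x hx => by simp [f1, hx]
  have g2 : ∀ x, q x = 1 → (φ x).b = 0 := fun x hx => by simp [f2, hx]
  have hD1 : D 1 = 0 := by simpa using hD 1 1
  have hDinv : ∀ x, D x⁻¹ = - D x := fun x => by
    have := hD x x⁻¹
    rw [mul_inv_cancel, hD1] at this
    exact (neg_eq_of_add_eq_zero_right this.symm).symm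
  have c1 : (φ 1).c = 0 := by rw [map_one]; rfl
  let S : Subgroup (Coprod G (FreeGroup (Fin (m + 1)))) :=
    { carrier := {x | q x = 1 ∧ ∃ e : Fin m → ℤ, D x = ∑ i, (e i : ℂ) • D (r i) ∧
        (φ x).c = ∑ i, (e i : ZMod n) * (φ (r i)).c}
      one_mem' := ⟨map_one q, 0, by simp [hD1], by rw [c1]; simp⟩
      mul_mem' := by
        rintro x y ⟨hx, e, h1, h2⟩ ⟨hy, ee, k1, k2⟩
        refine ⟨by simp [hx, hy], e + ee, ?_, ?_⟩
        · simp [hD, h1, k1, add_smul, Finset.sum_add_distrib]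
        · rw [map_mul, heisG_mul_c, g1 x hx, h2, k2]
          simp [add_mul, Finset.sum_add_distrib]
      inv_mem' := by
        rintro x ⟨hx, e, h1, h2⟩
        refine ⟨by simp [hx], -e, ?_, ?_⟩
        · simp [hDinv, h1]
        · have h3 := heisG_mul_c (φ x) (φ x⁻¹)
          rw [← map_mul, mul_inv_cancel, c1, g1 x hx, h2] at h3
          simp only [Pi.neg_apply, Int.cast_neg, neg_mul, Finset.sum_neg_distrib]
          linear_combination -h3 }
  have hSn : S.Normal := by
    refine ⟨?_⟩
    rintro x ⟨hx, e, h1, h2⟩ y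
    refine ⟨by simp [hx], e, ?_, ?_⟩
    · rw [hD, hD, hDinv, ← h1]; abel
    · have h3 := heisG_mul_c (φ (y * x * y⁻¹)) (φ y)
      rw [← map_mul, inv_mul_cancel_right, map_mul, heisG_mul_c, g1 (y * x * y⁻¹) (by simp [hx]),
        g2 x hx] at h3
      rw [← h2]
      linear_combination -h3
  have hNS : q.ker ≤ S := by
    rw [hq]
    apply Subgroup.normalClosure_le_normal
    rintro _ ⟨i, rfl⟩
    refine ⟨hr i, Pi.single i 1, ?_, ?_⟩
    · rw [Finset.sum_eq_single i]
      · simp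
      · intro j _ hj
        simp [hj]
      · simp
    · rw [Finset.sum_eq_single i]
      · simp
      · intro j _ hj
        simp [hj]
      · simp
  have hc : a * t * a⁻¹ * t⁻¹ ∈ q.ker := by
    rw [MonoidHom.mem_ker]
    simp [mul_comm]
  obtain ⟨hq1, e, h1, h2⟩ := hNS hc
  have h0 : D (a * t * a⁻¹ * t⁻¹) = 0 := by
    rw [hD, hD, hD, hDinv, hDinv]; abel
  rw [h0] at h1
  have he := Fintype.linearIndependent_iff.1 hli2 (fun i => (e i : ℂ)) h1.symm
  have heZ : ∀ i, e i = 0 := fun i => by exact_mod_cast he i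
  simp only [heZ, Int.cast_zero, zero_mul, Finset.sum_const_zero] at h2
  have h4 := heisG_mul_c (φ (a * t * a⁻¹ * t⁻¹)) (φ (t * a))
  have h5 : a * t * a⁻¹ * t⁻¹ * (t * a) = a * t := by group
  rw [← map_mul, h5, h2, g1 _ hq1, map_mul, map_mul, heisG_mul_c, heisG_mul_c] at h4
  have a1 : (φ a).a = 1 := by simp [f1, ha]
  have t1 : (φ t).a = 0 := by simp [f1, ht]
  have t2 : (φ t).b = 1 := by simp [f2, ht]
  rw [a1, t1, t2] at h4
  have h6 : (1 : ZMod n) = 0 := by linear_combination h4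
  have : Subsingleton (ZMod n) := subsingleton_of_zero_eq_one h6.symm
  rw [ZMod.subsingleton_iff] at this
  exact hn this

theorem torsion_to_int {G : Type*} [Group G] (hG : Monoid.IsTorsion (Abelianization G))
    (f : G →* Multiplicative ℤ) (g : G) : f g = 1 := by
  obtain ⟨n, hn, h⟩ := isOfFinOrder_iff_pow_eq_one.1 (hG (Abelianization.of g))
  have h1 := congrArg (Abelianization.lift f) h
  rw [map_pow, map_one, Abelianization.lift_apply_of] at h1
  have h2 : n • Multiplicative.toAdd (f g) = 0 := congrArg Multiplicative.toAdd h1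
  apply Multiplicative.toAdd.injective
  rcases smul_eq_zero.1 h2 with h | h
  · omega
  · simpa using h

open Monoid in
theorem main_aux {G : Type*} [Group G] (hG : Monoid.IsTorsion (Abelianization G))
    {n : ℕ} [NeZero n] (hn : n ≠ 1) (k : ℕ)
    (r : Fin (k - 1) → Coprod G (FreeGroup (Fin k)))
    (q : Coprod G (FreeGroup (Fin k)) →* Multiplicative (ZMod n) × Multiplicative ℤ)
    (hs : Function.Surjective q)
    (hq : q.ker = Subgroup.normalClosure (Set.range r)) : False := by
  have hG2 : ∀ g, (q (Coprod.inl g)).2 = 1 := fun g =>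
    torsion_to_int hG (((MonoidHom.snd _ _).comp q).comp Coprod.inl) g
  rcases k with _ | m
  · have : (MonoidHom.snd _ _).comp q = 1 := by
      apply Coprod.hom_ext
      · ext g
        simp [hG2]
      · ext i
        exact i.elim0
    obtain ⟨t, ht⟩ := hs (1, Multiplicative.ofAdd 1)
    have h := DFunLike.congr_fun this t
    simp [ht] at h
  · by_cases hg : ∀ g, q (Coprod.inl g) = 1
    · exact case_two hn r q hs hq hg
    · push Not at hg
      obtain ⟨g, hg⟩ := hg
      have hg1 : (q (Coprod.inl g)).1 ≠ 1 := fun h => hg (Prod.ext h (hG2 g))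
      have : Finite (Multiplicative (ZMod n)) := inferInstanceAs (Finite (ZMod n))
      obtain ⟨χ, hχ⟩ := CommGroup.exists_apply_ne_one_of_hasEnoughRootsOfUnity
        (Multiplicative (ZMod n)) ℂ hg1
      exact case_one r q hq (χ.comp (MonoidHom.fst _ _)) g hχ

/-- Let `Γ` be a nontrivial finite cyclic group and let `G` be a group whose
abelianization has rank 0 (i.e. `Abelianization G` is a torsion group). Then `Γ × ℤ` cannot be
expressed as a quotient of the free product `G * ℤ^{*k}` (here `FreeGroup (Fin k)` is the free
product of `k` copies of `ℤ`) by the normal closure of `k - 1` elements `r 1, …, r (k-1)`. -/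
theorem stmt_0 {Γ G : Type*} [Group Γ] [Finite Γ] [IsCyclic Γ] [Nontrivial Γ]
    [Group G] (hG : Monoid.IsTorsion (Abelianization G))
    (k : ℕ) (r : Fin (k - 1) → Monoid.Coprod G (FreeGroup (Fin k))) :
    ¬ Nonempty ((Γ × Multiplicative ℤ) ≃*
      Monoid.Coprod G (FreeGroup (Fin k)) ⧸ Subgroup.normalClosure (Set.range r)) := by
  rintro ⟨E⟩
  have hn : Nat.card Γ ≠ 1 := Finite.one_lt_card.ne'
  have : NeZero (Nat.card Γ) := ⟨Nat.card_pos.ne'⟩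
  let z : Multiplicative (ZMod (Nat.card Γ)) ≃* Γ := zmodCyclicMulEquiv inferInstance
  let F := E.symm.trans (MulEquiv.prodCongr z.symm (MulEquiv.refl (Multiplicative ℤ)))
  refine main_aux hG hn k r (F.toMonoidHom.comp (QuotientGroup.mk' _)) ?_ ?_
  · exact F.surjective.comp (QuotientGroup.mk'_surjective _)
  · ext x
    rw [MonoidHom.mem_ker]
    change F (QuotientGroup.mk' _ x) = 1 ↔ _
    rw [map_eq_one_iff F F.injective, ← MonoidHom.mem_ker, QuotientGroup.ker_mk']
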